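/- Fix an integer k ≥ 2, a real constant C ≥ 1, and reals g > 0 and ε ≥ 0 satisfying k/g ≤ (1/C)·(1/(C·k))^{1/(k−1)} − (1/(C·k))^{k/(k−1)} and ε ≤ (1/C)·(1/(C·k))^{1/(k−1)} − (1/(C·k))^{k/(k−1)} − k/g. Let γ t := g·k^t, and define K and S_γ as follows. For natural numbers M, m define K(M, m) := (k·M)! · binom(k·M − 1, m − 1) / m! (as a real number). For a natural number t_m define S_γ(t_m, ε, ε₀) as the finite sum, over all pairs of sequences n, e : {0,…,t_m} → ℕ satisfying n 0 = 1, e t ≤ n t for all t ≤ t_m, 1 ≤ n (t+1) ≤ k·(n t − e t) for all t < t_m, and e t_m = n t_m, of the term [∏_{t=0}^{t_m−1} binom(n t, e t) · K(n t − e t, n (t+1)) · ε^{e t} · C^{k·(n t − e t)} · (γ t)^{−(k·(n t − e t) − n (t+1))}] · ε₀^{n t_m}. Then for every natural number t_m: S_γ(t_m, ε, ε) ≤ x̃, where x̃ := (1/C)·(1/(C·k))^{1/(k−1)} − k/g. -/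

import Mathlib

/-- `K(M, m) = (k·M)! · binom(k·M − 1, m − 1) / m!`, the bound on the number of ways to
arrange the `k·M` lines leaving `M` sites so that they enter exactly `m` sites. -/
noncomputable def K (k M m : ℕ) : ℝ :=
  (Nat.factorial (k * M) : ℝ) * ((k * M - 1).choose (m - 1) : ℝ) / (Nat.factorial m : ℝ)

/-- `S γ (t_m, ε, ε₀)`: the weighted sum over graphs of height `t_m`, indexed by pairs of
sequences `n, e : {0,…,t_m} → ℕ` with `n 0 = 1`, `e t ≤ n t`, `1 ≤ n (t+1) ≤ k·(n t − e t)`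
for `t < t_m`, and `e t_m = n t_m`.  (Since these constraints force `n t ≤ k^t ≤ k^{t_m}`,
taking values in `Fin (k^{t_m} + 1)` captures every admissible pair of sequences.) -/
noncomputable def S (k : ℕ) (C : ℝ) (γ : ℕ → ℝ) (tm : ℕ) (ε ε₀ : ℝ) : ℝ :=
  ∑ ne ∈ Finset.univ.filter
      (fun ne : (Fin (tm + 1) → Fin (k ^ tm + 1)) × (Fin (tm + 1) → Fin (k ^ tm + 1)) =>
        (ne.1 0 : ℕ) = 1 ∧
        (∀ t : Fin (tm + 1), (ne.2 t : ℕ) ≤ (ne.1 t : ℕ)) ∧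
        (∀ t : Fin tm, 1 ≤ (ne.1 t.succ : ℕ) ∧
          (ne.1 t.succ : ℕ) ≤ k * ((ne.1 t.castSucc : ℕ) - (ne.2 t.castSucc : ℕ))) ∧
        (ne.2 (Fin.last tm) : ℕ) = (ne.1 (Fin.last tm) : ℕ)),
    (∏ t : Fin tm,
        ((ne.1 t.castSucc : ℕ).choose (ne.2 t.castSucc : ℕ) : ℝ) *
          K k ((ne.1 t.castSucc : ℕ) - (ne.2 t.castSucc : ℕ)) (ne.1 t.succ : ℕ) *
          ε ^ (ne.2 t.castSucc : ℕ) *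
          C ^ (k * ((ne.1 t.castSucc : ℕ) - (ne.2 t.castSucc : ℕ))) *
          (γ (t : ℕ) ^ (k * ((ne.1 t.castSucc : ℕ) - (ne.2 t.castSucc : ℕ)) -
              (ne.1 t.succ : ℕ)))⁻¹) *
      ε₀ ^ (ne.1 (Fin.last tm) : ℕ)

theorem sum_pi_snoc {α M : Type*} [Fintype α] [AddCommMonoid M] {n : ℕ}
    (f : (Fin (n + 1) → α) → M) :
    ∑ p, f p = ∑ p : Fin n → α, ∑ a, f (Fin.snoc (α := fun _ => α) p a) := by
  rw [← (Fin.snocEquiv (fun _ : Fin (n + 1) => α)).sum_comp, Fintype.sum_prod_type,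
    Finset.sum_comm]
  rfl

/-- If `y` is superharmonic for the nonnegative weights `w`, then the weighted sum over all paths
started at `a₀` is at most `y a₀`. -/
theorem sum_paths_le {α β : Type*} [Fintype α] [Fintype β] [DecidableEq α]
    (w : ℕ → α → β → α → ℝ) (hw : ∀ t a b a', 0 ≤ w t a b a') (y : α → ℝ)
    (hy : ∀ t a, ∑ b, ∑ a', w t a b a' * y a' ≤ y a) (a₀ : α) (T : ℕ)
    (ψ : α → β → ℝ) (hψ : ∀ a, ∑ b, ψ a b ≤ y a) :
    ∑ p : (Fin (T + 1) → α) × (Fin (T + 1) → β),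
      (if p.1 0 = a₀ then
        (∏ t : Fin T, w t (p.1 t.castSucc) (p.2 t.castSucc) (p.1 t.succ)) *
          ψ (p.1 (Fin.last T)) (p.2 (Fin.last T)) else 0) ≤ y a₀ := by
  induction T generalizing ψ with
  | zero =>
    rw [Fintype.sum_prod_type, ← (Equiv.funUnique (Fin 1) α).symm.sum_comp]
    simp_rw [← (Equiv.funUnique (Fin 1) β).symm.sum_comp]
    rw [Finset.sum_eq_single a₀]
    · simpa [Equiv.funUnique] using hψ a₀
    · intro a _ ha
      simp [Equiv.funUnique, ha]
    · simp
  | succ T ih =>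
    refine le_trans ?_ (ih (fun a b => ∑ a', w T a b a' * y a') (hy T))
    rw [Fintype.sum_prod_type, Fintype.sum_prod_type, sum_pi_snoc]
    refine Finset.sum_le_sum fun p _ => ?_
    have key : ∀ (a' : α) (b' : β) (q : Fin (T + 1) → β),
        (if (Fin.snoc (α := fun _ => α) p a' : Fin (T + 2) → α) 0 = a₀ then
          (∏ t : Fin (T + 1), w t ((Fin.snoc (α := fun _ => α) p a' : Fin (T + 2) → α) t.castSucc)
            ((Fin.snoc (α := fun _ => β) q b' : Fin (T + 2) → β) t.castSucc)
            ((Fin.snoc (α := fun _ => α) p a' : Fin (T + 2) → α) t.succ)) *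
            ψ ((Fin.snoc (α := fun _ => α) p a' : Fin (T + 2) → α) (Fin.last (T + 1)))
              ((Fin.snoc (α := fun _ => β) q b' : Fin (T + 2) → β) (Fin.last (T + 1))) else 0) =
        (if p 0 = a₀ then
          (∏ t : Fin T, w t (p t.castSucc) (q t.castSucc) (p t.succ)) *
            (w T (p (Fin.last T)) (q (Fin.last T)) a' * ψ a' b') else 0) := by
      intro a' b' q
      have h0 : (Fin.snoc (α := fun _ => α) p a' : Fin (T + 2) → α) 0 = p 0 := by
        rw [← Fin.castSucc_zero, Fin.snoc_castSucc]
      rw [h0, Fin.prod_univ_castSucc]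
      simp only [Fin.snoc_castSucc, Fin.snoc_last, Fin.succ_last, Fin.succ_castSucc,
        Fin.val_castSucc, Fin.val_last]
      rw [mul_assoc]
    refine (Finset.sum_congr rfl fun a' _ => sum_pi_snoc _).trans_le ?_
    simp_rw [key]
    rw [Finset.sum_comm]
    refine Finset.sum_le_sum fun q _ => ?_
    split_ifs with h
    · simp_rw [← Finset.mul_sum]
      refine mul_le_mul_of_nonneg_left ?_ (Finset.prod_nonneg fun _ _ => hw _ _ _ _)
      exact Finset.sum_le_sum fun a' _ => mul_le_mul_of_nonneg_left (hψ a') (hw _ _ _ _)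
    · simp

theorem K_nonneg (k M m : ℕ) : 0 ≤ K k M m := by
  unfold K
  positivity

theorem K_le {k M m : ℕ} (hm : 1 ≤ m) (hmM : m ≤ k * M) :
    K k M m ≤ ((k * M).choose m : ℝ) * (k * M : ℝ) ^ (k * M - m) := by
  have hfac : (k * M).factorial ≤ (k * M) ^ (k * M - m) * m.factorial := by
    have h := Nat.factorial_mul_descFactorial (n := k * M) (k := k * M - m) (Nat.sub_le _ _)
    rw [Nat.sub_sub_self hmM] at h
    rw [← h, mul_comm]
    exact Nat.mul_le_mul_right _ (Nat.descFactorial_le_pow _ _)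
  have hchoose : (k * M - 1).choose (m - 1) ≤ (k * M).choose m := by
    obtain ⟨a, ha⟩ : ∃ a, k * M = a + 1 := ⟨k * M - 1, by omega⟩
    obtain ⟨b, rfl⟩ : ∃ b, m = b + 1 := ⟨m - 1, by omega⟩
    rw [ha, Nat.choose_succ_succ]
    simp
  unfold K
  rw [div_le_iff₀ (by positivity)]
  have : (k * M).factorial * (k * M - 1).choose (m - 1) ≤
      (k * M).choose m * (k * M) ^ (k * M - m) * m.factorial := by
    calc _ ≤ ((k * M) ^ (k * M - m) * m.factorial) * (k * M).choose m :=
          Nat.mul_le_mul hfac hchoose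
      _ = _ := by ring
  exact_mod_cast this

/-- The weight of one generation of a graph. -/
noncomputable def stepWeight (k : ℕ) (C γ ε : ℝ) (n e m : ℕ) : ℝ :=
  (n.choose e : ℝ) * K k (n - e) m * ε ^ e * C ^ (k * (n - e)) * (γ ^ (k * (n - e) - m))⁻¹

theorem stepWeight_nonneg {k : ℕ} {C γ ε : ℝ} (hC : 0 ≤ C) (hγ : 0 ≤ γ) (hε : 0 ≤ ε)
    (n e m : ℕ) : 0 ≤ stepWeight k C γ ε n e m := by
  have := K_nonneg k (n - e) m
  unfold stepWeight
  positivity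

theorem sum_stepWeight_mul_pow_le {k : ℕ} {C γ ε y r : ℝ} (hC : 0 ≤ C) (hγ : 0 < γ) (hε : 0 ≤ ε)
    (hy : 0 ≤ y) {n : ℕ} (e : ℕ) (hr : k * n ≤ r * γ) (s : Finset ℕ) :
    ∑ m ∈ s with 1 ≤ m ∧ m ≤ k * (n - e), stepWeight k C γ ε n e m * y ^ m ≤
      (n.choose e : ℝ) * ε ^ e * ((C * (y + r)) ^ k) ^ (n - e) := by
  have hr0 : 0 ≤ r := by
    by_contra! h
    have : (0 : ℝ) ≤ k * n := by positivity
    nlinarith [mul_neg_of_neg_of_pos h hγ]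
  set M := n - e with hM
  have hMn : (k * M : ℝ) ≤ r * γ := by
    refine le_trans ?_ hr
    gcongr
    omega
  calc _ ≤ ∑ m ∈ s with 1 ≤ m ∧ m ≤ k * M,
        (n.choose e : ℝ) * ε ^ e * C ^ (k * M) *
          (y ^ m * r ^ (k * M - m) * ((k * M).choose m : ℝ)) := by
        refine Finset.sum_le_sum fun m hm => ?_
        obtain ⟨-, hm1, hmM⟩ := Finset.mem_filter.mp hm
        have hK : K k M m * (γ ^ (k * M - m))⁻¹ ≤ r ^ (k * M - m) * ((k * M).choose m : ℝ) := by
          rw [← div_eq_mul_inv, div_le_iff₀ (by positivity)]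
          calc _ ≤ ((k * M).choose m : ℝ) * (k * M : ℝ) ^ (k * M - m) := K_le hm1 hmM
            _ ≤ ((k * M).choose m : ℝ) * (r * γ) ^ (k * M - m) := by gcongr
            _ = _ := by rw [mul_pow]; ring
        calc _ = (n.choose e : ℝ) * ε ^ e * C ^ (k * M) *
              (y ^ m * (K k M m * (γ ^ (k * M - m))⁻¹)) := by
              unfold stepWeight
              ring
          _ ≤ (n.choose e : ℝ) * ε ^ e * C ^ (k * M) *
              (y ^ m * (r ^ (k * M - m) * ((k * M).choose m : ℝ))) := by gcongr
          _ = _ := by ring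
    _ ≤ ∑ m ∈ Finset.range (k * M + 1), (n.choose e : ℝ) * ε ^ e * C ^ (k * M) *
          (y ^ m * r ^ (k * M - m) * ((k * M).choose m : ℝ)) := by
        refine Finset.sum_le_sum_of_subset_of_nonneg (fun m hm => ?_) fun _ _ _ => by positivity
        have := (Finset.mem_filter.mp hm).2.2
        exact Finset.mem_range.mpr (by omega)
    _ = _ := by
        rw [← Finset.mul_sum, ← add_pow, ← pow_mul, mul_pow]
        ring

theorem sum_sum_stepWeight_le {k : ℕ} {C γ ε y r : ℝ} (hC : 0 ≤ C) (hγ : 0 < γ) (hε : 0 ≤ ε)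
    (hy : 0 ≤ y) {n : ℕ} (hr : k * n ≤ r * γ) (hr0 : 0 ≤ r)
    (hinv : ε + (C * (y + r)) ^ k ≤ y) (s : Finset ℕ) :
    ∑ e ∈ s with e ≤ n, ∑ m ∈ s with 1 ≤ m ∧ m ≤ k * (n - e),
      stepWeight k C γ ε n e m * y ^ m ≤ y ^ n := by
  calc _ ≤ ∑ e ∈ s with e ≤ n, ε ^ e * ((C * (y + r)) ^ k) ^ (n - e) * (n.choose e : ℝ) := by
        refine Finset.sum_le_sum fun e _ => ?_
        refine (sum_stepWeight_mul_pow_le hC hγ hε hy e hr s).trans_eq ?_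
        ring
    _ ≤ ∑ e ∈ Finset.range (n + 1),
          ε ^ e * ((C * (y + r)) ^ k) ^ (n - e) * (n.choose e : ℝ) := by
        refine Finset.sum_le_sum_of_subset_of_nonneg (fun m hm => ?_) fun _ _ _ => by positivity
        have := (Finset.mem_filter.mp hm).2
        exact Finset.mem_range.mpr (by omega)
    _ = (ε + (C * (y + r)) ^ k) ^ n := (add_pow _ _ _).symm
    _ ≤ _ := pow_le_pow_left₀ (by positivity) hinv n

/-- A fixed upper bound of the renormalization map bounds the graph sum of every height. -/
theorem S_le_of_invariant {k : ℕ} (hk : 1 ≤ k) {C g ε y : ℝ} (hC : 0 ≤ C) (hg : 0 < g)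
    (hε : 0 ≤ ε) (hinv : ε + (C * (y + k / g)) ^ k ≤ y) (hy : 0 ≤ y) (hεy : ε ≤ y) (tm : ℕ) :
    S k C (fun t => g * (k : ℝ) ^ t) tm ε ε ≤ y := by
  have hk0 : (0 : ℝ) < k := by exact_mod_cast hk
  have hγ : ∀ t : ℕ, 0 < g * (k : ℝ) ^ t := fun t => by positivity
  set N := k ^ tm with hN
  have hN1 : 1 ≤ N := Nat.one_le_pow _ _ hk
  let w : ℕ → Fin (N + 1) → Fin (N + 1) → Fin (N + 1) → ℝ := fun t n e m =>
    if (n : ℕ) ≤ k ^ t ∧ (e : ℕ) ≤ n ∧ 1 ≤ (m : ℕ) ∧ (m : ℕ) ≤ k * (n - e) then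
      stepWeight k C (g * (k : ℝ) ^ t) ε n e m else 0
  have hw : ∀ t a b a', 0 ≤ w t a b a' := fun t a b a' => by
    dsimp only [w]
    split_ifs
    · exact stepWeight_nonneg hC (hγ t).le hε _ _ _
    · exact le_rfl
  have hsuper : ∀ t (a : Fin (N + 1)), ∑ b, ∑ a', w t a b a' * y ^ (a' : ℕ) ≤ y ^ (a : ℕ) := by
    intro t a
    by_cases ha : (a : ℕ) ≤ k ^ t
    · have hr : (k : ℝ) * (a : ℕ) ≤ k / g * (g * (k : ℝ) ^ t) := by
        have : ((a : ℕ) : ℝ) ≤ (k : ℝ) ^ t := by exact_mod_cast ha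
        calc _ ≤ (k : ℝ) * (k : ℝ) ^ t := by gcongr
          _ = _ := by field_simp
      refine le_trans (le_of_eq ?_) (sum_sum_stepWeight_le hC (hγ t) hε hy hr (by positivity) hinv
        (Finset.range (N + 1)))
      rw [Finset.sum_filter, ← Fin.sum_univ_eq_sum_range (fun e => if e ≤ (a : ℕ) then
        ∑ m ∈ Finset.range (N + 1) with 1 ≤ m ∧ m ≤ k * (a - e),
          stepWeight k C (g * (k : ℝ) ^ t) ε a e m * y ^ m else 0)]
      refine Finset.sum_congr rfl fun e _ => ?_
      by_cases he : (e : ℕ) ≤ a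
      · rw [if_pos he, Finset.sum_filter, ← Fin.sum_univ_eq_sum_range
          (fun m => if 1 ≤ m ∧ m ≤ k * ((a : ℕ) - e) then
            stepWeight k C (g * (k : ℝ) ^ t) ε a e m * y ^ m else 0)]
        refine Finset.sum_congr rfl fun m _ => ?_
        simp only [w, ha, he, true_and, ite_mul, zero_mul]
      · simp only [w, he, false_and, and_false, if_false, zero_mul, Finset.sum_const_zero]
    · simp only [w, ha, false_and, if_false, zero_mul, Finset.sum_const_zero]
      positivity
  have main := sum_paths_le w hw (fun a => y ^ (a : ℕ)) hsuper ⟨1, by omega⟩ tm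
    (fun a b => if b = a then ε ^ (a : ℕ) else 0)
    (fun a => by
      rw [Finset.sum_ite_eq' Finset.univ a fun _ => ε ^ (a : ℕ), if_pos (Finset.mem_univ a)]
      exact pow_le_pow_left₀ hε hεy _)
  simp only [pow_one] at main
  refine le_trans ?_ main
  unfold S
  refine (Finset.sum_le_sum fun p hp => ?_).trans
    (Finset.sum_le_sum_of_subset_of_nonneg (Finset.filter_subset _ _) fun p _ _ => ?_)
  · obtain ⟨-, h0, hle, hstep, hlast⟩ := Finset.mem_filter.mp hp
    have hbound : ∀ t : Fin (tm + 1), (p.1 t : ℕ) ≤ k ^ (t : ℕ) := by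
      intro t
      induction t using Fin.induction with
      | zero => simp [h0]
      | succ t ih =>
        refine (hstep t).2.trans ?_
        rw [Fin.val_succ, pow_succ']
        exact Nat.mul_le_mul_left _ ((Nat.sub_le _ _).trans ih)
    rw [if_pos (Fin.ext h0), if_pos (Fin.ext hlast)]
    refine le_of_eq ?_
    congr 1
    refine Finset.prod_congr rfl fun t _ => ?_
    exact (if_pos ⟨hbound t.castSucc, hle _, hstep t⟩).symm
  · have hprod := Finset.prod_nonneg fun (t : Fin tm) (_ : t ∈ Finset.univ) =>
      hw t (p.1 t.castSucc) (p.2 t.castSucc) (p.1 t.succ)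
    split_ifs <;> positivity

/-- With `γ t = g·k^t`, iterating the renormalization recursion shows that the graph sum
of any height `t_m` is bounded by `x̃ = (1/C)·(1/(C·k))^{1/(k−1)} − k/g`. -/
theorem S_le_xtilde (k : ℕ) (hk : 2 ≤ k) (C : ℝ) (hC : 1 ≤ C) (g ε : ℝ)
    (hg : 0 < g) (hε : 0 ≤ ε)
    (hgcond : (k : ℝ) / g ≤ (1 / C) * (1 / (C * k)) ^ ((1 : ℝ) / (k - 1)) -
        (1 / (C * k)) ^ ((k : ℝ) / (k - 1)))
    (hεcond : ε ≤ (1 / C) * (1 / (C * k)) ^ ((1 : ℝ) / (k - 1)) -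
        (1 / (C * k)) ^ ((k : ℝ) / (k - 1)) - (k : ℝ) / g)
    (tm : ℕ) :
    S k C (fun t => g * (k : ℝ) ^ t) tm ε ε ≤
      (1 / C) * (1 / (C * k)) ^ ((1 : ℝ) / (k - 1)) - (k : ℝ) / g := by
  set u : ℝ := (1 / (C * k)) ^ ((1 : ℝ) / (k - 1)) with hu
  have hC0 : 0 < C := by linarith
  have hk0 : (0 : ℝ) < k := by positivity
  have hpow : (1 / (C * k)) ^ ((k : ℝ) / (k - 1)) = u ^ k := by
    rw [hu, ← Real.rpow_natCast, ← Real.rpow_mul (by positivity)]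
    congr 1
    ring
  rw [hpow] at hgcond hεcond
  have huk : 0 ≤ u ^ k := by positivity
  refine S_le_of_invariant (by omega) hC0.le hg hε ?_ (by linarith) (by linarith) tm
  have : C * (1 / C * u - k / g + k / g) = u := by field_simp; ring
  rw [this]
  linarith
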